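/- arXiv:2304.06735 — 6 statements merged into one kernel-verified Lean document; each statement's English description precedes it below -/
import Mathlib

section
/- The link product of rank-one positive semidefinite matrices is the rank-one matrix of the vector link product: for finite types X, Y, Z and vectors v : X × Y → ℂ and w : Y × Z → ℂ, the link product of the matrices Matrix.vecMulVec v (star v) and Matrix.vecMulVec w (star w) equals Matrix.vecMulVec (v ⋆ w) (star (v ⋆ w)), where v ⋆ w : X × Z → ℂ is the vector link product (v ⋆ w) (x, z) = ∑ y, v (x, y) * w (y, z), and star denotes entrywise complex conjugation. -/
/-- The link product of matrices over the shared index `Y`. -/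
noncomputable def linkProd {X Y Z : Type*} [Fintype Y]
    (A : Matrix (X × Y) (X × Y) ℂ) (B : Matrix (Y × Z) (Y × Z) ℂ) :
    Matrix (X × Z) (X × Z) ℂ :=
  Matrix.of fun p q => ∑ y : Y, ∑ y' : Y, A (p.1, y) (q.1, y') * B (y, p.2) (y', q.2)

/-- The link product of vectors over the shared index `Y`. -/
noncomputable def vecLink {X Y Z : Type*} [Fintype Y]
    (v : X × Y → ℂ) (w : Y × Z → ℂ) : X × Z → ℂ :=
  fun p => ∑ y : Y, v (p.1, y) * w (y, p.2)

/-- The link product of rank-one positive semidefinite matrices is the rank-one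
matrix of the vector link product. -/
theorem linkProd_vecMulVec {X Y Z : Type*} [Fintype Y]
    (v : X × Y → ℂ) (w : Y × Z → ℂ) :
    linkProd (Matrix.vecMulVec v (star v)) (Matrix.vecMulVec w (star w)) =
      Matrix.vecMulVec (vecLink v w) (star (vecLink v w)) := by
  ext p q
  simp only [linkProd, vecLink, Matrix.of_apply, Matrix.vecMulVec_apply, Pi.star_apply,
    star_sum, star_mul', Finset.sum_mul_sum, mul_mul_mul_comm]
end

section
/- The link product preserves hermiticity and positive semidefiniteness: for finite types X, Y, Z and matrices A : Matrix (X × Y) (X × Y) ℂ, B : Matrix (Y × Z) (Y × Z) ℂ, if A and B are Hermitian (A.IsHermitian and B.IsHermitian) then A * B is Hermitian, and if A and B are positive semidefinite (A.PosSemidef and B.PosSemidef) then A * B is positive semidefinite. -/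
open scoped ComplexOrder

/-- Summing a positive semidefinite matrix over the first component of both indices yields a positive
semidefinite matrix. -/
theorem Matrix.PosSemidef.sum_sum_fst {Y W : Type*} [Fintype Y] [Fintype W]
    {M : Matrix (Y × W) (Y × W) ℂ} (hM : M.PosSemidef) :
    (Matrix.of fun w w' => ∑ y : Y, ∑ y' : Y, M (y, w) (y', w')).PosSemidef := by
  classical
  convert hM.conjTranspose_mul_mul_same
    ((1 : Matrix W W ℂ).submatrix (Prod.snd : Y × W → W) id) using 1
  ext w w'
  simp only [Matrix.of_apply, Matrix.mul_apply, Matrix.conjTranspose_apply, Matrix.submatrix_apply,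
    Matrix.one_apply, Fintype.sum_prod_type, id_eq, apply_ite star, star_one, star_zero, ite_mul,
    one_mul, zero_mul, mul_ite, mul_one, mul_zero, Finset.sum_ite_eq', Finset.mem_univ, if_true]
  exact Finset.sum_comm

/-- The link product preserves hermiticity and positive semidefiniteness. -/
theorem linkProd_isHermitian_posSemidef {X Y Z : Type*}
    [Fintype X] [Fintype Y] [Fintype Z]
    (A : Matrix (X × Y) (X × Y) ℂ) (B : Matrix (Y × Z) (Y × Z) ℂ) :
    (A.IsHermitian → B.IsHermitian → (linkProd A B).IsHermitian) ∧
      (A.PosSemidef → B.PosSemidef → (linkProd A B).PosSemidef) := by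
  refine ⟨fun hA hB => ?_, fun hA hB => ?_⟩
  · ext p q
    simp only [linkProd, Matrix.conjTranspose_apply, Matrix.of_apply, star_sum, star_mul',
      hA.apply, hB.apply]
    exact Finset.sum_comm
  · exact ((hA.submatrix fun r : Y × X × Z => (r.2.1, r.1)).hadamard
      (hB.submatrix fun r : Y × X × Z => (r.1, r.2.2))).sum_sum_fst
end

section
/- The two expressions defining the link product coincide: let X, Y, Z be finite types and A : Matrix (X × Y) (X × Y) ℂ, B : Matrix (Y × Z) (Y × Z) ℂ. Let C : Matrix (X × Y × Z) (X × Y × Z) ℂ be the matrix C (x, y, z) (x', y', z') = A (x, y') (x', y) * (if z = z' then 1 else 0) (the partial transpose of A on Y, tensored with the identity on Z), and let D : Matrix (X × Y × Z) (X × Y × Z) ℂ be D (x, y, z) (x', y', z') = (if x = x' then 1 else 0) * B (y, z) (y', z') (the identity on X tensored with B). Then the partial trace over Y of the matrix product C · D equals the link product: for all x x' : X and z z' : Z, ∑ y, (C * D) (x, y, z) (x', y, z') = (A * B) (x, z) (x', z'). -/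
/-- The two expressions defining the link product coincide: the partial trace
over `Y` of `(A^{T_Y} ⊗ 𝟙_Z) (𝟙_X ⊗ B)` equals the link product `A * B`. -/
theorem trace_form_eq_linkProd {X Y Z : Type*}
    [Fintype X] [Fintype Y] [Fintype Z] [DecidableEq X] [DecidableEq Z]
    (A : Matrix (X × Y) (X × Y) ℂ) (B : Matrix (Y × Z) (Y × Z) ℂ)
    (C : Matrix (X × Y × Z) (X × Y × Z) ℂ)
    (hC : ∀ (x x' : X) (y y' : Y) (z z' : Z),
      C (x, y, z) (x', y', z') = A (x, y') (x', y) * (if z = z' then 1 else 0))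
    (D : Matrix (X × Y × Z) (X × Y × Z) ℂ)
    (hD : ∀ (x x' : X) (y y' : Y) (z z' : Z),
      D (x, y, z) (x', y', z') = (if x = x' then 1 else 0) * B (y, z) (y', z')) :
    ∀ (x x' : X) (z z' : Z),
      ∑ y : Y, (C * D) (x, y, z) (x', y, z') = linkProd A B (x, z) (x', z') := by
  intro x x' z z'
  simp only [Matrix.mul_apply, Fintype.sum_prod_type, hC, hD, linkProd, Matrix.of_apply]
  refine Eq.trans ?_ Finset.sum_comm
  refine Finset.sum_congr rfl fun y _ => ?_
  rw [Finset.sum_eq_single x' (fun b _ hb => by simp [hb]) (by simp)]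
  simp
end

section
/- Isometry condition for internal operations (abstract form of the paper's Lemma 'krausiso'): let E and F be finite-dimensional complex inner product spaces, ι, κ, μ finite types, g : ι → κ a function (the control update), and V : ι → μ → (E →ₗ[ℂ] F) a family of linear maps (the internal-operation blocks). Define the block operator T : PiLp 2 (fun _ : ι => E) →ₗ[ℂ] PiLp 2 (fun _ : κ × μ => F) by (T x) (c, m) = ∑ i ∈ {i | g i = c}, V i m (x i). If T preserves the inner product (⟪T x, T y⟫ = ⟪x, y⟫ for all x, y), then for all i j : ι with g i = g j, ∑ m, (V i m).adjoint ∘ₗ (V j m) = if i = j then LinearMap.id else 0. (In the QC-QC setting, i stands for the control (𝒦_{n-1}, k_n), g (𝒦_{n-1}, k_n) = 𝒦_{n-1} ∪ {k_n}, m stands for k_{n+1}, and V i m for the internal operation V^{→k_{n+1}}_{𝒦_{n-1}, k_n}.) -/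
open scoped InnerProductSpace

/-- Isometry condition for the internal operations of a QC-QC: if the block
operator `T`, with blocks `V i m` and control update `g`, preserves the inner
product, then `∑ m, (V i m)† ∘ (V j m) = δ_{i j} · id` whenever `g i = g j`. -/
theorem internal_isometry_condition
    {E F : Type*} [NormedAddCommGroup E] [InnerProductSpace ℂ E]
    [NormedAddCommGroup F] [InnerProductSpace ℂ F]
    [FiniteDimensional ℂ E] [FiniteDimensional ℂ F]
    {ι κ μ : Type*} [Fintype ι] [Fintype κ] [Fintype μ]
    [DecidableEq ι] [DecidableEq κ]
    (g : ι → κ) (V : ι → μ → (E →ₗ[ℂ] F))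
    (T : PiLp 2 (fun _ : ι => E) →ₗ[ℂ] PiLp 2 (fun _ : κ × μ => F))
    (hT : ∀ (x : PiLp 2 (fun _ : ι => E)) (c : κ) (m : μ),
      T x (c, m) = ∑ i ∈ Finset.univ.filter (fun i => g i = c), V i m (x i))
    (hiso : ∀ x y : PiLp 2 (fun _ : ι => E), ⟪T x, T y⟫_ℂ = ⟪x, y⟫_ℂ) :
    ∀ i j : ι, g i = g j →
      ∑ m : μ, (LinearMap.adjoint (V i m)) ∘ₗ (V j m) =
        if i = j then LinearMap.id else 0 := by
  intro i j hij
  have hsingle : ∀ (k : ι) (v : E) (c : κ) (m : μ),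
      T (PiLp.single 2 k v) (c, m) = if g k = c then V k m v else 0 := by
    intro k v c m
    rw [hT, Finset.sum_filter, Finset.sum_eq_single k]
    · simp
    · intro l _ hl
      simp [hl]
    · simp
  ext v
  refine ext_inner_left ℂ fun u => ?_
  have h := hiso (PiLp.single 2 i u) (PiLp.single 2 j v)
  rw [PiLp.inner_apply, Fintype.sum_prod_type, Finset.sum_eq_single (g i)] at h
  · simp only [hsingle, hij, if_true] at h
    simp only [LinearMap.sum_apply, LinearMap.comp_apply, inner_sum,
      LinearMap.adjoint_inner_right, h, PiLp.inner_apply]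
    rw [Finset.sum_eq_single i]
    · by_cases e : i = j
      · subst e; simp
      · simp [e]
    · intro l _ hl
      simp [hl]
    · simp
  · intro c _ hc
    simp [hsingle, hc.symm]
  · simp
end

section
/- Inner product of symmetrized tensors (the Fock-space inner product formula): for a finite type α, n : ℕ, and ψ φ : Fin n → EuclideanSpace ℂ α, one has ⟪⊙ψ, ⊙φ⟫ = ∑_{π ∈ Equiv.Perm (Fin n)} ∏_{k : Fin n} ⟪ψ k, φ (π k)⟫, where ⊙ψ is the symmetrized tensor product and the inner products are those of EuclideanSpace ℂ (Fin n → α) and EuclideanSpace ℂ α respectively. -/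
open scoped InnerProductSpace

/-- The symmetrized tensor product of a family `ψ : Fin n → ℓ²(α)`, as an
element of the `n`-fold tensor power `ℓ²(Fin n → α)`. -/
noncomputable def symmTensor {α : Type*} [Fintype α] {n : ℕ}
    (ψ : Fin n → EuclideanSpace ℂ α) : EuclideanSpace ℂ (Fin n → α) :=
  (WithLp.equiv 2 _).symm fun v =>
    ((Real.sqrt (Nat.factorial n) : ℝ) : ℂ)⁻¹ * ∑ π : Equiv.Perm (Fin n), ∏ k : Fin n, ψ (π k) (v k)

/-- The inner product of two pure tensors is the product of the inner products of the factors. -/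
lemma sum_conj_prod_mul_prod {ι α : Type*} [Fintype ι] [DecidableEq ι] [Fintype α]
    (ψ φ : ι → EuclideanSpace ℂ α) :
    ∑ v : ι → α, (starRingEnd ℂ) (∏ k, ψ k (v k)) * ∏ k, φ k (v k) = ∏ k, ⟪ψ k, φ k⟫_ℂ := by
  simp only [PiLp.inner_apply, RCLike.inner_apply, map_prod, ← Finset.prod_mul_distrib,
    Fintype.prod_sum, mul_comm]

lemma conj_inv_sqrt_factorial_mul_self (n : ℕ) :
    (starRingEnd ℂ) ((Real.sqrt (Nat.factorial n) : ℝ) : ℂ)⁻¹ *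
      ((Real.sqrt (Nat.factorial n) : ℝ) : ℂ)⁻¹ = (Nat.factorial n : ℂ)⁻¹ := by
  rw [map_inv₀, Complex.conj_ofReal, ← mul_inv, ← Complex.ofReal_mul,
    Real.mul_self_sqrt (Nat.cast_nonneg _), Complex.ofReal_natCast]

/-- A double sum over permutations of products relating two permuted families is `n!` times the
single sum in which the first family is left in place. -/
lemma sum_sum_perm_prod {n : ℕ} (f : Fin n → Fin n → ℂ) :
    ∑ σ : Equiv.Perm (Fin n), ∑ τ : Equiv.Perm (Fin n), ∏ k, f (σ k) (τ k) =
      Nat.factorial n * ∑ π : Equiv.Perm (Fin n), ∏ k, f k (π k) := by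
  have h (σ : Equiv.Perm (Fin n)) :
      ∑ τ : Equiv.Perm (Fin n), ∏ k, f (σ k) (τ k) =
        ∑ π : Equiv.Perm (Fin n), ∏ k, f k (π k) := by
    rw [← Equiv.sum_comp (Equiv.mulRight σ)]
    exact Finset.sum_congr rfl fun π _ => Equiv.prod_comp σ fun k => f k (π k)
  simp [h, Fintype.card_perm]

/-- The Fock-space inner product formula: the inner product of two symmetrized
tensors is the sum over permutations of products of single-message inner
products. -/
theorem inner_symmTensor {α : Type*} [Fintype α] {n : ℕ}
    (ψ φ : Fin n → EuclideanSpace ℂ α) :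
    ⟪symmTensor ψ, symmTensor φ⟫_ℂ =
      ∑ π : Equiv.Perm (Fin n), ∏ k : Fin n, ⟪ψ k, φ (π k)⟫_ℂ := by
  calc ⟪symmTensor ψ, symmTensor φ⟫_ℂ
      = (Nat.factorial n : ℂ)⁻¹ * ∑ v : Fin n → α,
          (starRingEnd ℂ) (∑ σ : Equiv.Perm (Fin n), ∏ k, ψ (σ k) (v k)) *
            ∑ τ : Equiv.Perm (Fin n), ∏ k, φ (τ k) (v k) := by
        rw [PiLp.inner_apply, Finset.mul_sum]
        refine Finset.sum_congr rfl fun v _ => ?_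
        rw [RCLike.inner_apply', ← conj_inv_sqrt_factorial_mul_self]
        simp only [symmTensor, WithLp.equiv_symm_apply, map_mul]
        ring
    _ = (Nat.factorial n : ℂ)⁻¹ * ∑ σ : Equiv.Perm (Fin n), ∑ τ : Equiv.Perm (Fin n),
          ∏ k, ⟪ψ (σ k), φ (τ k)⟫_ℂ := by
        congr 1
        simp only [← sum_conj_prod_mul_prod, map_sum, Finset.sum_mul_sum]
        rw [Finset.sum_comm]
        exact Finset.sum_congr rfl fun σ _ => Finset.sum_comm
    _ = ∑ π : Equiv.Perm (Fin n), ∏ k, ⟪ψ k, φ (π k)⟫_ℂ := by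
        rw [sum_sum_perm_prod fun i j => ⟪ψ i, φ j⟫_ℂ,
          inv_mul_cancel_left₀ (Nat.cast_ne_zero.mpr n.factorial_ne_zero)]
end

section
/- The inner product of symmetrized tensors equals the permanent of the Gram matrix: for a finite type α, n : ℕ, and ψ φ : Fin n → EuclideanSpace ℂ α, one has ⟪⊙ψ, ⊙φ⟫ = (Matrix.of fun k l => ⟪ψ k, φ l⟫).permanent, where ⊙ψ is the symmetrized tensor product and Matrix.permanent A = ∑_{π ∈ Equiv.Perm (Fin n)} ∏_{k} A k (π k). -/
open scoped InnerProductSpace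

open scoped ComplexConjugate

theorem sum_conj_prod_mul_prod_eq_prod_inner {α ι : Type*} [Fintype α] [Fintype ι] [DecidableEq ι]
    (ψ φ : ι → EuclideanSpace ℂ α) :
    ∑ v : ι → α, conj (∏ k, ψ k (v k)) * ∏ k, φ k (v k) = ∏ k, ⟪ψ k, φ k⟫_ℂ := by
  simp only [PiLp.inner_apply, RCLike.inner_apply', Finset.prod_univ_sum, Fintype.piFinset_univ,
    map_prod, Finset.prod_mul_distrib]

theorem Matrix.sum_perm_sum_perm_prod_eq {ι R : Type*} [Fintype ι] [DecidableEq ι]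
    [CommSemiring R] (M : Matrix ι ι R) :
    ∑ π : Equiv.Perm ι, ∑ σ : Equiv.Perm ι, ∏ k, M (π k) (σ k) =
      (Fintype.card ι).factorial * M.permanent := by
  have h (σ : Equiv.Perm ι) : ∑ π : Equiv.Perm ι, ∏ k, M (π k) (σ k) = M.permanent :=
    Matrix.permanent_permute_rows σ M
  rw [Finset.sum_comm]
  simp [h, Fintype.card_perm]

/-- The inner product of symmetrized tensors equals the permanent of the Gram
matrix of the two families. -/
theorem inner_symmTensor_eq_permanent {α : Type*} [Fintype α] {n : ℕ}
    (ψ φ : Fin n → EuclideanSpace ℂ α) :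
    ⟪symmTensor ψ, symmTensor φ⟫_ℂ =
      (Matrix.of fun k l : Fin n => ⟪ψ k, φ l⟫_ℂ).permanent := by
  have hc : conj ((Real.sqrt (Nat.factorial n) : ℝ) : ℂ)⁻¹ *
      ((Real.sqrt (Nat.factorial n) : ℝ) : ℂ)⁻¹ * (Nat.factorial n : ℂ) = 1 := by
    have h0 : (Nat.factorial n : ℂ) ≠ 0 := by exact_mod_cast n.factorial_ne_zero
    rw [map_inv₀, Complex.conj_ofReal, ← mul_inv, ← Complex.ofReal_mul,
      Real.mul_self_sqrt (Nat.cast_nonneg _), Complex.ofReal_natCast, inv_mul_cancel₀ h0]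
  have hsum : ∑ v : Fin n → α, conj (∑ π : Equiv.Perm (Fin n), ∏ k, ψ (π k) (v k)) *
      ∑ σ : Equiv.Perm (Fin n), ∏ k, φ (σ k) (v k) =
      (Nat.factorial n : ℂ) * (Matrix.of fun k l : Fin n => ⟪ψ k, φ l⟫_ℂ).permanent := by
    have h := Matrix.sum_perm_sum_perm_prod_eq (Matrix.of fun k l : Fin n => ⟪ψ k, φ l⟫_ℂ)
    rw [Fintype.card_fin] at h
    rw [← h]
    simp only [map_sum, Finset.sum_mul_sum, Matrix.of_apply]
    rw [Finset.sum_comm]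
    refine Finset.sum_congr rfl fun π _ => ?_
    rw [Finset.sum_comm]
    exact Finset.sum_congr rfl fun σ _ =>
      sum_conj_prod_mul_prod_eq_prod_inner (fun k => ψ (π k)) fun k => φ (σ k)
  calc ⟪symmTensor ψ, symmTensor φ⟫_ℂ
      = conj ((Real.sqrt (Nat.factorial n) : ℝ) : ℂ)⁻¹ *
          ((Real.sqrt (Nat.factorial n) : ℝ) : ℂ)⁻¹ *
          ∑ v : Fin n → α, conj (∑ π : Equiv.Perm (Fin n), ∏ k, ψ (π k) (v k)) *
            ∑ σ : Equiv.Perm (Fin n), ∏ k, φ (σ k) (v k) := by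
        simp only [symmTensor, PiLp.inner_apply, RCLike.inner_apply',
          WithLp.equiv_symm_apply, Finset.mul_sum (s := (Finset.univ : Finset (Fin n → α)))]
        refine Finset.sum_congr rfl fun v _ => ?_
        rw [map_mul, mul_mul_mul_comm]
    _ = _ := by rw [hsum, ← mul_assoc, hc, one_mul]
end
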